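/- arXiv:1608.02203 — 2 statements merged into one kernel-verified Lean document; each statement's English description precedes it below -/
import Mathlib

section
/- Let d_A, d_B, d_E be positive natural numbers, V an isometry from ℂ^{d_A} to ℂ^{d_B} ⊗ ℂ^{d_E} with associated channel Φ(ρ) = Tr_E(V ρ Vᴴ), and let S_c be a nonempty compact subset of the set S_{d_A} of states on ℂ^{d_A}. Then there exists a Borel probability measure μ* on S_{d_A} supported by pure states (μ* assigns measure 1 to the set of rank-one projections) such that ρ̄(μ*) ∈ S_c and χ(Φ(μ*)) = sup { χ(Φ(μ)) : μ a Borel probability measure on S_{d_A} with ρ̄(μ) ∈ S_c }, where ρ̄(μ) = ∫ ρ μ(dρ) and χ(Φ(μ)) = H(Φ(ρ̄(μ))) − ∫ H(Φ(ρ)) μ(dρ). -/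
open MeasureTheory ComplexOrder Matrix

noncomputable section

instance matMS {m n : Type*} : MeasurableSpace (Matrix m n ℂ) :=
  inferInstanceAs (MeasurableSpace (m → n → ℂ))

instance matBS {m n : Type*} [Countable m] [Countable n] : BorelSpace (Matrix m n ℂ) :=
  inferInstanceAs (BorelSpace (m → n → ℂ))

/-- The set of quantum states (density matrices). -/
def stateSet (n : ℕ) : Set (Matrix (Fin n) (Fin n) ℂ) :=
  {ρ | ρ.PosSemidef ∧ ρ.trace = 1}

/-- Von Neumann entropy: sum of `negMulLog` over eigenvalues. -/
def vnEntropy {ι : Type*} [Fintype ι] [DecidableEq ι] (ρ : Matrix ι ι ℂ) : ℝ :=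
  if h : ρ.IsHermitian then ∑ i, Real.negMulLog (h.eigenvalues i) else 0

/-- Partial trace over the second (environment) factor. -/
def ptraceE {dB dE : ℕ} (M : Matrix (Fin dB × Fin dE) (Fin dB × Fin dE) ℂ) :
    Matrix (Fin dB) (Fin dB) ℂ :=
  Matrix.of fun b b' => ∑ e, M (b, e) (b', e)

/-- Partial trace over the first factor. -/
def ptraceB {dB dE : ℕ} (M : Matrix (Fin dB × Fin dE) (Fin dB × Fin dE) ℂ) :
    Matrix (Fin dE) (Fin dE) ℂ :=
  Matrix.of fun e e' => ∑ b, M (b, e) (b, e')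

/-- Quantum mutual information I(B:E) of a bipartite state. -/
def qmi {dB dE : ℕ} (ω : Matrix (Fin dB × Fin dE) (Fin dB × Fin dE) ℂ) : ℝ :=
  vnEntropy (ptraceE ω) + vnEntropy (ptraceB ω) - vnEntropy ω

/-- The channel `ρ ↦ Tr_E (V ρ V†)` associated with a Stinespring isometry `V`. -/
def chanPhi {dA dB dE : ℕ} (V : Matrix (Fin dB × Fin dE) (Fin dA) ℂ)
    (ρ : Matrix (Fin dA) (Fin dA) ℂ) : Matrix (Fin dB) (Fin dB) ℂ :=
  ptraceE (V * ρ * Vᴴ)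

/-- The complementary channel `ρ ↦ Tr_B (V ρ V†)`. -/
def chanPhiHat {dA dB dE : ℕ} (V : Matrix (Fin dB × Fin dE) (Fin dA) ℂ)
    (ρ : Matrix (Fin dA) (Fin dA) ℂ) : Matrix (Fin dE) (Fin dE) ℂ :=
  ptraceB (V * ρ * Vᴴ)

/-- Barycenter (average state) of a generalized ensemble. -/
def barycenter {n : ℕ} (μ : ProbabilityMeasure (stateSet n)) :
    Matrix (Fin n) (Fin n) ℂ :=
  Matrix.of fun i j => ∫ ρ : stateSet n, ρ.1 i j ∂(μ : Measure (stateSet n))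

/-- Output χ-quantity of a generalized ensemble under a map `Φ`. -/
def gChiOut {n d : ℕ} (Φ : Matrix (Fin n) (Fin n) ℂ → Matrix (Fin d) (Fin d) ℂ)
    (μ : ProbabilityMeasure (stateSet n)) : ℝ :=
  vnEntropy (Φ (barycenter μ)) -
    ∫ ρ : stateSet n, vnEntropy (Φ ρ.1) ∂(μ : Measure (stateSet n))

/-- χ-quantity of a generalized ensemble. -/
def gChi {n : ℕ} (μ : ProbabilityMeasure (stateSet n)) : ℝ :=
  vnEntropy (barycenter μ) -
    ∫ ρ : stateSet n, vnEntropy ρ.1 ∂(μ : Measure (stateSet n))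

/-- Holevo χ-quantity of a finite ensemble. -/
def finChi {d m : ℕ} (π : Fin m → ℝ) (σ : Fin m → Matrix (Fin d) (Fin d) ℂ) : ℝ :=
  vnEntropy (∑ i, π i • σ i) - ∑ i, π i * vnEntropy (σ i)

/-- The set of pure states (rank-one projections) viewed inside the state space. -/
def pureStates (n : ℕ) : Set (stateSet n) := {ρ | ρ.1 * ρ.1 = ρ.1}

end


open scoped Matrix.Norms.L2Operator in
theorem cfc_cont_aux {X ι : Type*} [TopologicalSpace X] [Fintype ι] [DecidableEq ι]
    (f : ℝ → ℝ) (hf : Continuous f) (a : X → Matrix ι ι ℂ) (ha : Continuous a)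
    (hh : ∀ x, (a x).IsHermitian) : Continuous fun x => cfc f (a x) := by
  refine Continuous.cfc_of_mem_nhdsSet (s := Set.univ) f Filter.univ_mem ha (fun x => hh x)
    hf.continuousOn

theorem vnEntropy_eq_trace {ι : Type*} [Fintype ι] [DecidableEq ι] (A : Matrix ι ι ℂ)
    (hA : A.IsHermitian) : vnEntropy A = (cfc Real.negMulLog A).trace.re := by
  rw [vnEntropy, dif_pos hA, hA.cfc_eq, Matrix.IsHermitian.cfc, Unitary.conjStarAlgAut_apply,
    Matrix.trace_mul_comm, ← mul_assoc]
  simp [Matrix.trace]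

theorem vnEntropy_continuous {X ι : Type*} [TopologicalSpace X] [Fintype ι] [DecidableEq ι]
    (a : X → Matrix ι ι ℂ) (ha : Continuous a)
    (hh : ∀ x, (a x).IsHermitian) : Continuous fun x => vnEntropy (a x) := by
  simp_rw [fun x => vnEntropy_eq_trace (a x) (hh x)]
  exact Complex.continuous_re.comp
    (Continuous.matrix_trace (cfc_cont_aux _ Real.continuous_negMulLog a ha hh))

theorem diag_formula {ι : Type*} [Fintype ι] [DecidableEq ι] (X : Matrix ι ι ℂ) (l : ι → ℝ) (k : ι) :
    ((X * diagonal (fun j => (l j : ℂ)) * Xᴴ) k k).re = ∑ j, Complex.normSq (X k j) * l j := by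
  rw [Matrix.mul_apply, Complex.re_sum]
  refine Finset.sum_congr rfl fun j _ => ?_
  rw [Matrix.mul_diagonal, Matrix.conjTranspose_apply, mul_right_comm]
  simp only [RCLike.star_def, Complex.mul_conj]
  rw [← Complex.ofReal_mul, Complex.ofReal_re]

theorem unitary_row {ι : Type*} [Fintype ι] [DecidableEq ι] (X : Matrix ι ι ℂ) (h : X * Xᴴ = 1)
    (k : ι) : ∑ j, Complex.normSq (X k j) = 1 := by
  have := diag_formula X (fun _ => 1) k
  simp [h] at this
  exact this.symm

theorem unitary_col {ι : Type*} [Fintype ι] [DecidableEq ι] (X : Matrix ι ι ℂ) (h : Xᴴ * X = 1)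
    (j : ι) : ∑ k, Complex.normSq (X k j) = 1 := by
  have := unitary_row Xᴴ (by simpa using h) j
  simpa [Matrix.conjTranspose_apply] using this

theorem peierls {ι : Type*} [Fintype ι] [DecidableEq ι] (A : Matrix ι ι ℂ) (hA : A.PosSemidef)
    (U : Matrix ι ι ℂ) (hU : Uᴴ * U = 1) :
    vnEntropy A ≤ ∑ k, Real.negMulLog ((Uᴴ * A * U) k k).re := by
  have hU' : U * Uᴴ = 1 := mul_eq_one_comm.mp hU
  have hs := hA.isHermitian.spectral_theorem
  set W : Matrix ι ι ℂ := hA.isHermitian.eigenvectorUnitary.1 with hW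
  have hW1 : Wᴴ * W = 1 := Unitary.coe_star_mul_self hA.isHermitian.eigenvectorUnitary
  have hW2 : W * Wᴴ = 1 := mul_eq_one_comm.mp hW1
  set l := hA.isHermitian.eigenvalues with hl
  have hA2 : A = W * diagonal (fun j => (l j : ℂ)) * Wᴴ := hs
  set X := Uᴴ * W with hX
  have hX1 : Xᴴ * X = 1 := by
    rw [hX, Matrix.conjTranspose_mul, Matrix.conjTranspose_conjTranspose]
    calc Wᴴ * U * (Uᴴ * W) = Wᴴ * (U * Uᴴ) * W := by simp only [Matrix.mul_assoc]
      _ = 1 := by rw [hU', Matrix.mul_one, hW1]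
  have hX2 : X * Xᴴ = 1 := mul_eq_one_comm.mp hX1
  have hk : Uᴴ * A * U = X * diagonal (fun j => (l j : ℂ)) * Xᴴ := by
    rw [hX, Matrix.conjTranspose_mul, Matrix.conjTranspose_conjTranspose]
    conv_lhs => rw [hA2]
    simp only [Matrix.mul_assoc]
  rw [hk]
  simp_rw [diag_formula]
  have hle : ∀ k, ∑ j, Complex.normSq (X k j) * Real.negMulLog (l j) ≤
      Real.negMulLog (∑ j, Complex.normSq (X k j) * l j) := by
    intro k
    have := Real.concaveOn_negMulLog.le_map_sum (t := Finset.univ)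
      (w := fun j => Complex.normSq (X k j)) (p := l) (fun j _ => Complex.normSq_nonneg _)
      (unitary_row X hX2 k) (fun j _ => hA.eigenvalues_nonneg j)
    simpa [smul_eq_mul] using this
  refine le_trans ?_ (Finset.sum_le_sum fun k _ => hle k)
  rw [Finset.sum_comm]
  simp_rw [← Finset.sum_mul, unitary_col X hX1, one_mul]
  rw [vnEntropy, dif_pos hA.isHermitian]

theorem vnEntropy_concave {ι κ : Type*} [Fintype ι] [DecidableEq ι] [Fintype κ]
    (p : κ → ℝ) (hp : ∀ i, 0 ≤ p i) (hp1 : ∑ i, p i = 1) (σ : κ → Matrix ι ι ℂ)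
    (hσ : ∀ i, (σ i).PosSemidef) (ρ : Matrix ι ι ℂ) (hρ : ρ.IsHermitian)
    (h : ρ = ∑ i, (p i : ℂ) • σ i) : ∑ i, p i * vnEntropy (σ i) ≤ vnEntropy ρ := by
  have hs := hρ.spectral_theorem
  set U : Matrix ι ι ℂ := hρ.eigenvectorUnitary.1 with hW
  have hU : Uᴴ * U = 1 := Unitary.coe_star_mul_self hρ.eigenvectorUnitary
  have hA2 : ρ = U * diagonal (fun j => (hρ.eigenvalues j : ℂ)) * Uᴴ := hs
  have hd : Uᴴ * ρ * U = diagonal (fun j => (hρ.eigenvalues j : ℂ)) := by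
    conv_lhs => rw [hA2]
    calc _ = (Uᴴ * U) * diagonal (fun j => (hρ.eigenvalues j : ℂ)) * (Uᴴ * U) := by
          simp only [Matrix.mul_assoc]
      _ = _ := by rw [hU, Matrix.one_mul, Matrix.mul_one]
  have he : ∀ k, hρ.eigenvalues k = ∑ i, p i * ((Uᴴ * σ i * U) k k).re := by
    intro k
    have h1 : (Uᴴ * ρ * U) k k = hρ.eigenvalues k := by rw [hd]; simp
    rw [← Complex.ofReal_re (hρ.eigenvalues k), ← h1]
    conv_lhs => rw [h]
    simp [Matrix.mul_sum, Matrix.sum_mul, Matrix.sum_apply]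
  calc ∑ i, p i * vnEntropy (σ i)
      ≤ ∑ i, p i * ∑ k, Real.negMulLog ((Uᴴ * σ i * U) k k).re :=
        Finset.sum_le_sum fun i _ => mul_le_mul_of_nonneg_left (peierls _ (hσ i) U hU) (hp i)
    _ = ∑ k, ∑ i, p i * Real.negMulLog ((Uᴴ * σ i * U) k k).re := by
        simp_rw [Finset.mul_sum]; rw [Finset.sum_comm]
    _ ≤ ∑ k, Real.negMulLog (∑ i, p i * ((Uᴴ * σ i * U) k k).re) := by
        refine Finset.sum_le_sum fun k _ => ?_
        have := Real.concaveOn_negMulLog.le_map_sum (t := Finset.univ)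
          (w := p) (p := fun i => ((Uᴴ * σ i * U) k k).re) (fun j _ => hp j) hp1
          (fun j _ => by
            have := ((hσ j).conjTranspose_mul_mul_same U).diag_nonneg (i := k)
            exact (Complex.le_def.mp this).1)
        simpa [smul_eq_mul] using this
    _ = vnEntropy ρ := by
        rw [vnEntropy, dif_pos hρ]
        simp_rw [he]

/-- The positive square root of a matrix, by functional calculus. -/
noncomputable def rootMat {n : ℕ} (ρ : Matrix (Fin n) (Fin n) ℂ) : Matrix (Fin n) (Fin n) ℂ :=
  cfc Real.sqrt ρ

theorem rootMat_herm {n : ℕ} (ρ : Matrix (Fin n) (Fin n) ℂ) : (rootMat ρ)ᴴ = rootMat ρ :=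
  (cfc_predicate Real.sqrt ρ : IsSelfAdjoint (cfc Real.sqrt ρ))

theorem rootMat_sq {n : ℕ} (ρ : Matrix (Fin n) (Fin n) ℂ) (h : ρ.PosSemidef) :
    rootMat ρ * (rootMat ρ)ᴴ = ρ := by
  rw [rootMat_herm, rootMat]
  have hsa : IsSelfAdjoint ρ := h.isHermitian
  rw [← cfc_mul Real.sqrt Real.sqrt ρ Real.continuous_sqrt.continuousOn
    Real.continuous_sqrt.continuousOn]
  conv_rhs => rw [← cfc_id ℝ ρ hsa]
  refine cfc_congr fun x hx => ?_
  rw [h.isHermitian.spectrum_real_eq_range_eigenvalues] at hx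
  obtain ⟨i, rfl⟩ := hx
  exact Real.mul_self_sqrt (h.eigenvalues_nonneg i)

/-- The unnormalized pure components of a state. -/
noncomputable def comp0 {n : ℕ} (ρ : Matrix (Fin n) (Fin n) ℂ) (i : Fin n) :
    Matrix (Fin n) (Fin n) ℂ :=
  vecMulVec (fun j => rootMat ρ j i) (star fun j => rootMat ρ j i)

theorem comp0_sum {n : ℕ} (ρ : Matrix (Fin n) (Fin n) ℂ) (h : ρ.PosSemidef) :
    ∑ i, comp0 ρ i = ρ := by
  conv_rhs => rw [← rootMat_sq ρ h]
  ext j k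
  simp [comp0, Matrix.sum_apply, vecMulVec_apply, Matrix.mul_apply]

theorem comp0_psd {n : ℕ} (ρ : Matrix (Fin n) (Fin n) ℂ) (i : Fin n) :
    (comp0 ρ i).PosSemidef := posSemidef_vecMulVec_self_star _

theorem comp0_trace {n : ℕ} (ρ : Matrix (Fin n) (Fin n) ℂ) (h : ρ.PosSemidef) (i : Fin n) :
    (star fun j => rootMat ρ j i) ⬝ᵥ (fun j => rootMat ρ j i) = ((ρ i i).re : ℂ) := by
  have h1 : ((ρ i i).re : ℂ) = ρ i i := by
    have := h.isHermitian.apply i i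
    exact Complex.conj_eq_iff_re.mp this
  rw [h1]
  conv_rhs => rw [← rootMat_sq ρ h, rootMat_herm]
  rw [Matrix.mul_apply, dotProduct]
  refine Finset.sum_congr rfl fun j _ => ?_
  have : star (rootMat ρ j i) = rootMat ρ i j := by
    have := congrFun (congrFun (rootMat_herm ρ) i) j
    simpa [Matrix.conjTranspose_apply] using this
  simp only [Pi.star_apply]
  rw [this]

theorem diag_re_nonneg {n : ℕ} (ρ : Matrix (Fin n) (Fin n) ℂ) (h : ρ.PosSemidef) (i : Fin n) :
    0 ≤ (ρ i i).re := (Complex.le_def.mp (h.diag_nonneg (i := i))).1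

/-- The normalized pure components. -/
noncomputable def comp1 {n : ℕ} (ρ : Matrix (Fin n) (Fin n) ℂ) (i : Fin n) :
    Matrix (Fin n) (Fin n) ℂ :=
  if (ρ i i).re = 0 then vecMulVec (Pi.single i 1) (star (Pi.single i 1))
    else (((ρ i i).re)⁻¹ : ℂ) • comp0 ρ i

theorem comp1_eq {n : ℕ} (ρ : Matrix (Fin n) (Fin n) ℂ) (h : ρ.PosSemidef) (i : Fin n) :
    ((ρ i i).re : ℂ) • comp1 ρ i = comp0 ρ i := by
  rw [comp1]
  split_ifs with h0
  · have h1 := comp0_trace ρ h i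
    rw [h0, Complex.ofReal_zero] at h1
    have h2 := dotProduct_star_self_eq_zero.mp h1
    rw [h0, Complex.ofReal_zero, zero_smul, comp0, h2]
    simp
  · rw [smul_smul, mul_inv_cancel₀ (by exact_mod_cast h0), one_smul]

theorem comp1_pure {n : ℕ} (ρ : Matrix (Fin n) (Fin n) ℂ) (h : ρ.PosSemidef) (i : Fin n) :
    comp1 ρ i * comp1 ρ i = comp1 ρ i := by
  rw [comp1]
  split_ifs with h0
  · rw [vecMulVec_mul_vecMulVec]
    simp
  · rw [Matrix.smul_mul, Matrix.mul_smul]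
    have : comp0 ρ i * comp0 ρ i = ((ρ i i).re : ℂ) • comp0 ρ i := by
      rw [comp0, vecMulVec_mul_vecMulVec, comp0_trace ρ h]
      ext j k
      simp [vecMulVec_apply]; ring
    rw [this, smul_smul, smul_smul, mul_assoc, inv_mul_cancel₀ (by exact_mod_cast h0), mul_one]

theorem comp1_state {n : ℕ} (ρ : Matrix (Fin n) (Fin n) ℂ) (h : ρ.PosSemidef) (i : Fin n) :
    comp1 ρ i ∈ stateSet n := by
  rw [comp1]
  split_ifs with h0
  · refine ⟨posSemidef_vecMulVec_self_star _, ?_⟩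
    rw [trace_vecMulVec]
    simp
  · refine ⟨(comp0_psd ρ i).smul ?_, ?_⟩
    · rw [← Complex.ofReal_inv]
      exact_mod_cast inv_nonneg.mpr (diag_re_nonneg ρ h i)
    · rw [trace_smul, comp0, trace_vecMulVec, dotProduct_comm, comp0_trace ρ h, smul_eq_mul,
        inv_mul_cancel₀ (by exact_mod_cast h0)]

theorem diag_sum {n : ℕ} (ρ : Matrix (Fin n) (Fin n) ℂ) (h : ρ ∈ stateSet n) :
    ∑ i, (ρ i i).re = 1 := by
  have := congrArg Complex.re h.2
  simpa [Matrix.trace] using this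

theorem isCompact_stateSet (n : ℕ) : IsCompact (stateSet n) := by
  have hb : IsCompact (Set.pi Set.univ fun _ : Fin n => Set.pi Set.univ fun _ : Fin n =>
      Metric.closedBall (0:ℂ) n) :=
    isCompact_univ_pi fun _ => isCompact_univ_pi fun _ => isCompact_closedBall _ _
  refine IsCompact.of_isClosed_subset hb ?_ ?_
  · have : stateSet n = {ρ | ρᴴ = ρ} ∩ (⋂ x : Fin n → ℂ, {ρ | 0 ≤ star x ⬝ᵥ (ρ *ᵥ x)}) ∩
        {ρ | ρ.trace = 1} := by
      ext ρ
      simp [stateSet, posSemidef_iff_dotProduct_mulVec, Matrix.IsHermitian]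
    rw [this]
    refine ((isClosed_eq (by fun_prop) (by fun_prop)).inter
      (isClosed_iInter fun x => isClosed_le (by fun_prop) (by fun_prop))).inter
      (isClosed_eq (by fun_prop) (by fun_prop))
  · intro ρ hρ
    have hB : ∀ j i, ‖rootMat ρ j i‖ ≤ 1 := by
      intro j i
      have h1 := congrArg Complex.re (comp0_trace ρ hρ.1 i)
      have h2 : (ρ i i).re ≤ 1 := by
        rw [← diag_sum ρ hρ]
        exact Finset.single_le_sum (f := fun i => (ρ i i).re)
          (fun k _ => diag_re_nonneg ρ hρ.1 k) (Finset.mem_univ i)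
      have h3 : ‖rootMat ρ j i‖ ^ 2 ≤ (ρ i i).re := by
        rw [Complex.ofReal_re] at h1
        rw [← h1, dotProduct, Complex.re_sum]
        have h4 : ∀ k, ((star fun j => rootMat ρ j i) k * rootMat ρ k i).re =
            ‖rootMat ρ k i‖ ^ 2 := by
          intro k
          simp only [Pi.star_apply, RCLike.star_def, ← Complex.normSq_eq_conj_mul_self]
          rw [Complex.ofReal_re, Complex.normSq_eq_norm_sq]
        simp_rw [h4]
        exact Finset.single_le_sum (f := fun k => ‖rootMat ρ k i‖ ^ 2)
          (fun k _ => sq_nonneg _) (Finset.mem_univ j)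
      have := norm_nonneg (rootMat ρ j i)
      nlinarith
    intro j _ k _
    rw [mem_closedBall_zero_iff]
    conv_lhs => rw [← rootMat_sq ρ hρ.1]
    rw [Matrix.mul_apply]
    refine (norm_sum_le _ _).trans ?_
    calc ∑ i, ‖rootMat ρ j i * (rootMat ρ)ᴴ i k‖ ≤ ∑ i : Fin n, (1:ℝ) := by
          refine Finset.sum_le_sum fun i _ => ?_
          rw [norm_mul, rootMat_herm]
          exact mul_le_one₀ (hB _ _) (norm_nonneg _) (hB _ _)
      _ = n := by simp

instance compactSpace_stateSet (n : ℕ) : CompactSpace (stateSet n) :=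
  isCompact_iff_compactSpace.mp (isCompact_stateSet n)

/-- The `i`-th pure component as a map on the state space. -/
noncomputable def compMap {n : ℕ} (i : Fin n) (ρ : stateSet n) : stateSet n :=
  ⟨comp1 ρ.1 i, comp1_state ρ.1 ρ.2.1 i⟩

theorem continuous_entry {n : ℕ} (i j : Fin n) : Continuous fun ρ : stateSet n => ρ.1 i j :=
  continuous_subtype_val.matrix_elem i j

theorem compMap_measurable {n : ℕ} (i : Fin n) : Measurable (compMap (n := n) i) := by
  refine Measurable.subtype_mk ?_
  unfold comp1
  have hp : Continuous fun ρ : stateSet n => (ρ.1 i i).re :=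
    Complex.continuous_re.comp (continuous_entry i i)
  have hr : Continuous fun ρ : stateSet n => rootMat ρ.1 :=
    cfc_cont_aux _ Real.continuous_sqrt _ continuous_subtype_val fun ρ => ρ.2.1.isHermitian
  refine Measurable.ite (hp.measurable (measurableSet_singleton 0)) measurable_const ?_
  refine measurable_pi_iff.mpr fun j => measurable_pi_iff.mpr fun k => ?_
  have h1 : Continuous fun ρ : stateSet n => comp0 ρ.1 i j k := by
    simp only [comp0, vecMulVec_apply, Pi.star_apply]
    exact (hr.matrix_elem j i).mul (hr.matrix_elem k i).star
  simp only [Matrix.smul_apply, smul_eq_mul]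
  exact (Complex.measurable_ofReal.comp hp.measurable).inv.mul h1.measurable

/-- The weight of the `i`-th pure component. -/
noncomputable def wgt {n : ℕ} (i : Fin n) (ρ : stateSet n) : ℝ := (ρ.1 i i).re

theorem wgt_cont {n : ℕ} (i : Fin n) : Continuous (wgt i) :=
  Complex.continuous_re.comp (continuous_entry i i)

theorem wgt_nonneg {n : ℕ} (i : Fin n) (ρ : stateSet n) : 0 ≤ wgt i ρ :=
  diag_re_nonneg ρ.1 ρ.2.1 i

/-- The purified ensemble. -/
noncomputable def pureMeas {n : ℕ} (μ : Measure (stateSet n)) : Measure (stateSet n) :=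
  ∑ i, (μ.withDensity fun ρ => ENNReal.ofReal (wgt i ρ)).map (compMap i)

theorem pureMeas_one {n : ℕ} (μ : Measure (stateSet n)) [IsProbabilityMeasure μ]
    (s : Set (stateSet n)) (hs : MeasurableSet s) (h : ∀ i ρ, compMap i ρ ∈ s) :
    pureMeas μ s = 1 := by
  rw [pureMeas, Measure.finsetSum_apply]
  have : ∀ i, (Measure.map (compMap i) (μ.withDensity fun ρ => ENNReal.ofReal (wgt i ρ))) s
      = ∫⁻ ρ, ENNReal.ofReal (wgt i ρ) ∂μ := by
    intro i
    rw [Measure.map_apply (compMap_measurable i) hs]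
    have : compMap i ⁻¹' s = Set.univ := Set.eq_univ_of_forall fun ρ => h i ρ
    rw [this, withDensity_apply _ MeasurableSet.univ, Measure.restrict_univ]
  simp_rw [this]
  rw [← lintegral_finsetSum _ fun i _ => (wgt_cont i).measurable.ennreal_ofReal]
  have h1 : ∀ ρ : stateSet n, ∑ i, ENNReal.ofReal (wgt i ρ) = 1 := by
    intro ρ
    rw [← ENNReal.ofReal_sum_of_nonneg fun i _ => wgt_nonneg i ρ]
    unfold wgt
    rw [diag_sum ρ.1 ρ.2, ENNReal.ofReal_one]
  simp [h1]

theorem integrable_of_cont {n : ℕ} {E : Type*} [NormedAddCommGroup E] [SecondCountableTopology E]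
    [MeasurableSpace E] [BorelSpace E]
    (μ : Measure (stateSet n)) [IsFiniteMeasure μ]
    (g : stateSet n → E) (hg : Continuous g) : Integrable g μ := by
  obtain ⟨C, hC⟩ := isCompact_univ.exists_bound_of_continuousOn hg.continuousOn
  exact Integrable.of_bound hg.measurable.aestronglyMeasurable C
    (Filter.Eventually.of_forall fun x => hC x trivial)

theorem integrable_comp {n : ℕ} {E : Type*} [NormedAddCommGroup E] [NormedSpace ℝ E]
    [SecondCountableTopology E]
    [MeasurableSpace E] [BorelSpace E]
    (μ : Measure (stateSet n)) [IsFiniteMeasure μ]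
    (g : stateSet n → E) (hg : Continuous g) (i : Fin n) :
    Integrable (fun ρ => wgt i ρ • g (compMap i ρ)) μ := by
  obtain ⟨C, hC⟩ := isCompact_univ.exists_bound_of_continuousOn hg.continuousOn
  obtain ⟨D, hD⟩ := isCompact_univ.exists_bound_of_continuousOn (wgt_cont i).continuousOn
  refine Integrable.of_bound ((wgt_cont i).measurable.aestronglyMeasurable.smul
    (hg.measurable.comp (compMap_measurable i)).aestronglyMeasurable) (D * C)
    (Filter.Eventually.of_forall fun x => ?_)
  rw [norm_smul]
  exact mul_le_mul (hD x trivial) (hC _ trivial) (norm_nonneg _)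
    ((norm_nonneg _).trans (hD x trivial))

theorem pureMeas_integral {n : ℕ} {E : Type*} [NormedAddCommGroup E] [NormedSpace ℝ E]
    [SecondCountableTopology E]
    [MeasurableSpace E] [BorelSpace E]
    (μ : Measure (stateSet n)) [IsProbabilityMeasure μ] (hpm : IsProbabilityMeasure (pureMeas μ))
    (g : stateSet n → E) (hg : Continuous g) :
    ∫ ρ, g ρ ∂(pureMeas μ) = ∫ ρ, ∑ i, wgt i ρ • g (compMap i ρ) ∂μ := by
  have hle : ∀ i, (μ.withDensity fun ρ => ENNReal.ofReal (wgt i ρ)).map (compMap i)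
      ≤ pureMeas μ := by
    intro i
    refine Measure.le_intro fun s hs _ => ?_
    rw [pureMeas, Measure.finsetSum_apply]
    exact Finset.single_le_sum
      (f := fun i => (Measure.map (compMap i) (μ.withDensity fun ρ => ENNReal.ofReal (wgt i ρ))) s)
      (fun _ _ => zero_le) (Finset.mem_univ i)
  have hint := integrable_of_cont (pureMeas μ) g hg
  rw [pureMeas, integral_finsetSum_measure fun i _ => hint.mono_measure (hle i),
    integral_finsetSum _ fun i _ => integrable_comp μ g hg i]
  refine Finset.sum_congr rfl fun i _ => ?_
  rw [integral_map (compMap_measurable i).aemeasurable hg.measurable.aestronglyMeasurable,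
    integral_withDensity_eq_integral_toReal_smul (wgt_cont i).measurable.ennreal_ofReal
      (Filter.Eventually.of_forall fun _ => ENNReal.ofReal_lt_top)]
  simp_rw [fun ρ => ENNReal.toReal_ofReal (wgt_nonneg i ρ)]

theorem exists_purification {n : ℕ} (μ : ProbabilityMeasure (stateSet n)) (f : stateSet n → ℝ)
    (hf : Continuous f) (hc : ∀ ρ, ∑ i, wgt i ρ * f (compMap i ρ) ≤ f ρ) :
    ∃ ν : ProbabilityMeasure (stateSet n), (ν : Measure (stateSet n)) (pureStates n) = 1 ∧
      barycenter ν = barycenter μ ∧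
      ∫ ρ, f ρ ∂(ν : Measure (stateSet n)) ≤ ∫ ρ, f ρ ∂(μ : Measure (stateSet n)) := by
  have hpm : IsProbabilityMeasure (pureMeas (μ : Measure (stateSet n))) :=
    ⟨pureMeas_one _ _ MeasurableSet.univ fun _ _ => trivial⟩
  refine ⟨⟨pureMeas μ, hpm⟩, ?_, ?_, ?_⟩
  · refine pureMeas_one _ _ ?_ fun i ρ => comp1_pure ρ.1 ρ.2.1 i
    refine IsClosed.measurableSet (isClosed_eq ?_ ?_) <;> fun_prop
  · ext j k
    simp only [barycenter, Matrix.of_apply, ProbabilityMeasure.coe_mk]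
    rw [pureMeas_integral _ hpm _ (continuous_entry j k)]
    refine integral_congr_ae (Filter.Eventually.of_forall fun ρ => ?_)
    have h1 := congrFun (congrFun (comp0_sum ρ.1 ρ.2.1) j) k
    simp_rw [← comp1_eq ρ.1 ρ.2.1] at h1
    simpa [Matrix.sum_apply, wgt, compMap] using h1
  · simp only [ProbabilityMeasure.coe_mk]
    rw [pureMeas_integral _ hpm _ hf]
    refine integral_mono (integrable_finsetSum _ fun i _ => integrable_comp _ f hf i)
      (integrable_of_cont _ f hf) fun ρ => ?_
    simpa [smul_eq_mul] using hc ρ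

theorem chanPhi_cont {dA dB dE : ℕ} (V : Matrix (Fin dB × Fin dE) (Fin dA) ℂ) :
    Continuous (chanPhi V) := by
  unfold chanPhi ptraceE
  refine continuous_matrix fun i j => ?_
  simp only [Matrix.of_apply]
  refine continuous_finsetSum _ fun e _ => ?_
  exact Continuous.matrix_elem (by fun_prop) _ _

theorem chanPhi_sum {dA dB dE : ℕ} {κ : Type*} [Fintype κ] (V : Matrix (Fin dB × Fin dE) (Fin dA) ℂ)
    (c : κ → ℂ) (σ : κ → Matrix (Fin dA) (Fin dA) ℂ) :
    chanPhi V (∑ i, c i • σ i) = ∑ i, c i • chanPhi V (σ i) := by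
  ext b b'
  simp only [chanPhi, ptraceE, Matrix.of_apply, Matrix.mul_sum, Matrix.sum_mul, Matrix.sum_apply,
    Matrix.mul_smul, Matrix.smul_mul, Matrix.smul_apply, Finset.smul_sum]
  rw [Finset.sum_comm]

theorem ptraceE_psd {dB dE : ℕ} (M : Matrix (Fin dB × Fin dE) (Fin dB × Fin dE) ℂ)
    (h : M.PosSemidef) : (ptraceE M).PosSemidef := by
  have : ptraceE M = ∑ e, M.submatrix (fun b => (b, e)) (fun b => (b, e)) := by
    ext b b'
    simp [ptraceE, Matrix.sum_apply]
  rw [this]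
  exact posSemidef_sum _ fun e _ => h.submatrix _

theorem chanPhi_psd {dA dB dE : ℕ} (V : Matrix (Fin dB × Fin dE) (Fin dA) ℂ)
    (ρ : Matrix (Fin dA) (Fin dA) ℂ) (h : ρ.PosSemidef) : (chanPhi V ρ).PosSemidef :=
  ptraceE_psd _ (h.mul_mul_conjTranspose_same V)

theorem outEntropy_cont {dA dB dE : ℕ} (V : Matrix (Fin dB × Fin dE) (Fin dA) ℂ) :
    Continuous fun ρ : stateSet dA => vnEntropy (chanPhi V ρ.1) :=
  vnEntropy_continuous _ ((chanPhi_cont V).comp continuous_subtype_val)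
    fun ρ => (chanPhi_psd V ρ.1 ρ.2.1).isHermitian

theorem outEntropy_concave {dA dB dE : ℕ} (V : Matrix (Fin dB × Fin dE) (Fin dA) ℂ)
    (ρ : stateSet dA) :
    ∑ i, wgt i ρ * vnEntropy (chanPhi V (compMap i ρ).1) ≤ vnEntropy (chanPhi V ρ.1) := by
  refine vnEntropy_concave (fun i => wgt i ρ) (fun i => wgt_nonneg i ρ) (diag_sum ρ.1 ρ.2) _
    (fun i => chanPhi_psd V _ (compMap i ρ).2.1) _ (chanPhi_psd V ρ.1 ρ.2.1).isHermitian ?_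
  rw [← chanPhi_sum]
  congr 1
  conv_lhs => rw [← comp0_sum ρ.1 ρ.2.1]
  exact Finset.sum_congr rfl fun i _ => (comp1_eq ρ.1 ρ.2.1 i).symm

theorem barycenter_cont (n : ℕ) : Continuous (barycenter (n := n)) := by
  refine continuous_matrix fun i j => ?_
  simp only [barycenter, Matrix.of_apply]
  have hre := Complex.continuous_re.comp (continuous_entry (n := n) i j)
  have him := Complex.continuous_im.comp (continuous_entry (n := n) i j)
  have h1 := ProbabilityMeasure.continuous_integral_continuousMap
    (⟨_, hre⟩ : C(stateSet n, ℝ))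
  have h2 := ProbabilityMeasure.continuous_integral_continuousMap
    (⟨_, him⟩ : C(stateSet n, ℝ))
  have : ∀ μ : ProbabilityMeasure (stateSet n),
      ∫ ρ : stateSet n, ρ.1 i j ∂(μ : Measure (stateSet n)) =
      ((∫ ρ : stateSet n, (ρ.1 i j).re ∂(μ : Measure (stateSet n)) : ℝ) : ℂ) +
      ((∫ ρ : stateSet n, (ρ.1 i j).im ∂(μ : Measure (stateSet n)) : ℝ) : ℂ) * Complex.I :=
    fun μ => (integral_re_add_im (𝕜 := ℂ) (integrable_of_cont _ _ (continuous_entry i j))).symm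
  simp_rw [this]
  exact (Complex.continuous_ofReal.comp h1).add
    ((Complex.continuous_ofReal.comp h2).mul continuous_const)

/-- Existence of a χ-optimal ensemble supported by pure states, for the constraint that
the barycenter lies in a given nonempty compact subset of the state set. -/
theorem exists_chi_optimal_pure_ensemble
    (dA dB dE : ℕ) (hdA : 0 < dA) (hdB : 0 < dB) (hdE : 0 < dE)
    (V : Matrix (Fin dB × Fin dE) (Fin dA) ℂ) (hV : Vᴴ * V = 1)
    (Sc : Set (Matrix (Fin dA) (Fin dA) ℂ))
    (hScStates : Sc ⊆ stateSet dA) (hSc : IsCompact Sc) (hScNe : Sc.Nonempty) :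
    ∃ μs : ProbabilityMeasure (stateSet dA),
      (μs : Measure (stateSet dA)) (pureStates dA) = 1 ∧
      barycenter μs ∈ Sc ∧
      gChiOut (chanPhi V) μs
        = sSup {x : ℝ | ∃ μ : ProbabilityMeasure (stateSet dA),
            barycenter μ ∈ Sc ∧ gChiOut (chanPhi V) μ = x} := by
  set F : Set (ProbabilityMeasure (stateSet dA)) := {μ | barycenter μ ∈ Sc} with hF
  have hFc : IsCompact F := (hSc.isClosed.preimage (barycenter_cont dA)).isCompact
  have hFn : F.Nonempty := by
    obtain ⟨ρ, hρ⟩ := hScNe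
    refine ⟨⟨Measure.dirac ⟨ρ, hScStates hρ⟩, inferInstance⟩, ?_⟩
    have : barycenter (⟨Measure.dirac ⟨ρ, hScStates hρ⟩, inferInstance⟩ :
        ProbabilityMeasure (stateSet dA)) = ρ := by
      ext i j
      simp only [barycenter, Matrix.of_apply, ProbabilityMeasure.coe_mk]
      rw [integral_dirac' _ _ (continuous_entry i j).stronglyMeasurable]
    exact (congrArg (· ∈ Sc) this).mpr hρ
  have hcont : ContinuousOn (gChiOut (chanPhi V)) F := by
    unfold gChiOut
    refine ContinuousOn.sub ?_ ?_
    · rw [continuousOn_iff_continuous_domRestrict]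
      exact vnEntropy_continuous _
        (((chanPhi_cont V).comp (barycenter_cont dA)).comp continuous_subtype_val)
        fun μ => (chanPhi_psd V _ (hScStates μ.2).1).isHermitian
    · exact (ProbabilityMeasure.continuous_integral_continuousMap
        (⟨_, outEntropy_cont V⟩ : C(stateSet dA, ℝ))).continuousOn
  obtain ⟨μ, hμ, hmax⟩ := hFc.exists_isMaxOn hFn hcont
  obtain ⟨ν, hν1, hν2, hν3⟩ := exists_purification μ _ (outEntropy_cont V) (outEntropy_concave V)
  have hνF : barycenter ν ∈ Sc := by rw [hν2]; exact hμ
  refine ⟨ν, hν1, hνF, ?_⟩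
  have hgr : IsGreatest {x : ℝ | ∃ μ : ProbabilityMeasure (stateSet dA),
      barycenter μ ∈ Sc ∧ gChiOut (chanPhi V) μ = x} (gChiOut (chanPhi V) ν) := by
    refine ⟨⟨ν, hνF, rfl⟩, ?_⟩
    rintro x ⟨κ, hκ, rfl⟩
    have h1 : gChiOut (chanPhi V) κ ≤ gChiOut (chanPhi V) μ := hmax hκ
    refine h1.trans ?_
    unfold gChiOut
    rw [hν2]
    exact sub_le_sub_left hν3 _
  exact hgr.csSup_eq.symm
end

section
/- Let d_A, d_B, d_E be positive natural numbers and V an isometry from ℂ^{d_A} to ℂ^{d_B} ⊗ ℂ^{d_E}, with associated channel Φ(ρ) = Tr_E(V ρ Vᴴ). Then for every state ρ on ℂ^{d_A} there exists a Borel probability measure μ* on the set S_{d_A} of states, supported by pure states (μ* assigns measure 1 to the set of rank-one projections), such that ρ̄(μ*) = ρ and χ(Φ(μ*)) = sup { χ(Φ(μ)) : μ a Borel probability measure on S_{d_A} with ρ̄(μ) = ρ }, where ρ̄(μ) = ∫ σ μ(dσ) and χ(Φ(μ)) = H(Φ(ρ̄(μ))) − ∫ H(Φ(σ)) μ(dσ).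 -/
open MeasureTheory ComplexOrder Matrix

namespace ChiAux

section Abstract

set_option linter.unusedSectionVars false

variable {X : Type*} [TopologicalSpace X] [CompactSpace X] [T2Space X] [MeasurableSpace X]
  [BorelSpace X]

lemma integrable_cont (ν : ProbabilityMeasure X) {g : X → ℝ} (hg : Continuous g) :
    Integrable g (ν : Measure X) := by
  have := (BoundedContinuousFunction.mkOfCompact ⟨g, hg⟩).integrable (ν : Measure X)
  exact this

lemma continuous_integral {g : X → ℝ} (hg : Continuous g) :
    Continuous fun ν : ProbabilityMeasure X => ∫ x, g x ∂(ν : Measure X) :=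
  ProbabilityMeasure.continuous_integral_boundedContinuousFunction
    (BoundedContinuousFunction.mkOfCompact ⟨g, hg⟩)

lemma exists_mix {ι : Type*} [Fintype ι] (w : ι → ℝ) (hw0 : ∀ i, 0 ≤ w i) (hw1 : ∑ i, w i = 1)
    (ν : ι → ProbabilityMeasure X) :
    ∃ ν' : ProbabilityMeasure X, ∀ g : X → ℝ, Continuous g →
      ∫ x, g x ∂(ν' : Measure X) = ∑ i, w i * ∫ x, g x ∂(ν i : Measure X) := by
  refine ⟨⟨∑ i, ENNReal.ofReal (w i) • (ν i : Measure X), ⟨?_⟩⟩, ?_⟩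
  · simp only [Measure.finsetSum_apply, Measure.smul_apply, measure_univ, smul_eq_mul, mul_one]
    rw [← ENNReal.ofReal_sum_of_nonneg (fun i _ => hw0 i), hw1, ENNReal.ofReal_one]
  · intro g hg
    rw [ProbabilityMeasure.coe_mk, integral_finsetSum_measure]
    · refine Finset.sum_congr rfl fun i _ => ?_
      rw [integral_smul_measure, ENNReal.toReal_ofReal (hw0 i), smul_eq_mul]
    · intro i _
      exact (integrable_cont (ν i) hg).smul_measure ENNReal.ofReal_ne_top

open scoped Pointwise in
theorem exists_better {κ : Type*} [Fintype κ] (b : κ → X → ℝ) (hb : ∀ k, Continuous (b k))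
    (f : X → ℝ) (hf : Continuous f) (φ : X → ℝ) (hφ : Continuous φ)
    (h : ∀ x, ∃ ν : ProbabilityMeasure X, ∫ y, φ y ∂(ν : Measure X) = 0 ∧
      (∀ k, ∫ y, b k y ∂(ν : Measure X) = b k x) ∧ ∫ y, f y ∂(ν : Measure X) ≤ f x)
    (μ : ProbabilityMeasure X) :
    ∃ ν : ProbabilityMeasure X, ∫ y, φ y ∂(ν : Measure X) = 0 ∧
      (∀ k, ∫ y, b k y ∂(ν : Measure X) = ∫ y, b k y ∂(μ : Measure X)) ∧
      ∫ y, f y ∂(ν : Measure X) ≤ ∫ y, f y ∂(μ : Measure X) := by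
  let F : ProbabilityMeasure X → (κ → ℝ) × ℝ := fun ν =>
    (fun k => ∫ y, b k y ∂(ν : Measure X), ∫ y, f y ∂(ν : Measure X))
  have hF : Continuous F :=
    (continuous_pi fun k => continuous_integral (hb k)).prodMk (continuous_integral hf)
  let M : Set (ProbabilityMeasure X) := {ν | ∫ y, φ y ∂(ν : Measure X) = 0}
  have hM : IsCompact M := (isClosed_eq (continuous_integral hφ) continuous_const).isCompact
  let C := F '' M
  have hC : IsCompact C := hM.image hF
  have hCc : Convex ℝ C := by
    rintro _ ⟨ν₁, h₁, rfl⟩ _ ⟨ν₂, h₂, rfl⟩ a c ha hc hac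
    obtain ⟨ν, hν⟩ := exists_mix ![a, c] (by intro i; fin_cases i <;> simpa) (by simpa using hac)
      ![ν₁, ν₂]
    simp only [Fin.sum_univ_two, Matrix.cons_val_zero, Matrix.cons_val_one] at hν
    refine ⟨ν, ?_, ?_⟩
    · change ∫ y, φ y ∂(ν : Measure X) = 0
      rw [hν φ hφ, show ∫ y, φ y ∂(ν₁ : Measure X) = 0 from h₁,
        show ∫ y, φ y ∂(ν₂ : Measure X) = 0 from h₂]; simp
    · refine Prod.ext ?_ ?_
      · funext k
        simp [F, hν (b k) (hb k)]
      · simp [F, hν f hf]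
  let R : Set ((κ → ℝ) × ℝ) := {0} ×ˢ Set.Ici 0
  have hR : IsClosed R := isClosed_singleton.prod isClosed_Ici
  have hRc : Convex ℝ R := (convex_singleton 0).prod (convex_Ici 0)
  have hT : IsClosed (C + R) := hR.add_left_of_isCompact hC
  have hTc : Convex ℝ (C + R) := hCc.add hRc
  have hmem : ∀ x, ((fun k => b k x, f x) : (κ → ℝ) × ℝ) ∈ C + R := by
    intro x
    obtain ⟨ν, h0, h1, h2⟩ := h x
    refine ⟨F ν, ⟨ν, h0, rfl⟩, (0, f x - ∫ y, f y ∂(ν : Measure X)), ⟨rfl, ?_⟩, ?_⟩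
    · simpa using h2
    · refine Prod.ext ?_ ?_
      · funext k; simp [F, h1]
      · simp [F]
  have hi1 : ∀ k, Integrable (fun x => b k x) (μ : Measure X) := fun k => integrable_cont μ (hb k)
  have hi2 := integrable_cont μ hf
  have hi3 : Integrable (fun x => (fun k => b k x : κ → ℝ)) (μ : Measure X) :=
    Integrable.of_eval hi1
  have key := hTc.integral_mem (μ := (μ : Measure X)) hT (Filter.Eventually.of_forall hmem)
    (hi3.prodMk hi2)
  obtain ⟨_, ⟨ν, h0, rfl⟩, ⟨r1, r2⟩, ⟨hr1, hr2⟩, he⟩ := key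
  rw [integral_pair hi3 hi2] at he
  simp only [Set.mem_singleton_iff] at hr1
  subst hr1
  simp only [F, Prod.mk_add_mk, add_zero, Prod.mk.injEq] at he
  refine ⟨ν, h0, fun k => ?_, ?_⟩
  · have := congrFun he.1 k
    rw [eval_integral hi1] at this
    exact this
  · have : (0:ℝ) ≤ r2 := hr2
    linarith [he.2]

theorem exists_min {κ : Type*} [Fintype κ] (b : κ → X → ℝ) (hb : ∀ k, Continuous (b k))
    (f : X → ℝ) (hf : Continuous f) (φ : X → ℝ) (hφ : Continuous φ)
    (h : ∀ x, ∃ ν : ProbabilityMeasure X, ∫ y, φ y ∂(ν : Measure X) = 0 ∧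
      (∀ k, ∫ y, b k y ∂(ν : Measure X) = b k x) ∧ ∫ y, f y ∂(ν : Measure X) ≤ f x)
    (x : X) :
    ∃ ν : ProbabilityMeasure X, ∫ y, φ y ∂(ν : Measure X) = 0 ∧
      (∀ k, ∫ y, b k y ∂(ν : Measure X) = b k x) ∧
      ∀ μ : ProbabilityMeasure X, (∀ k, ∫ y, b k y ∂(μ : Measure X) = b k x) →
        ∫ y, f y ∂(ν : Measure X) ≤ ∫ y, f y ∂(μ : Measure X) := by
  let M : Set (ProbabilityMeasure X) := {ν | ∫ y, φ y ∂(ν : Measure X) = 0} ∩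
    ⋂ k, {ν | ∫ y, b k y ∂(ν : Measure X) = b k x}
  have hM : IsCompact M := ((isClosed_eq (continuous_integral hφ) continuous_const).inter
    (isClosed_iInter fun k => isClosed_eq (continuous_integral (hb k)) continuous_const)).isCompact
  obtain ⟨ν₀, h0, h1, -⟩ := h x
  obtain ⟨ν, hν, hmin⟩ := hM.exists_isMinOn ⟨ν₀, h0, Set.mem_iInter.2 h1⟩
    (continuous_integral hf).continuousOn
  refine ⟨ν, hν.1, fun k => Set.mem_iInter.1 hν.2 k, fun μ hμ => ?_⟩
  obtain ⟨ν', a0, a1, a2⟩ := exists_better b hb f hf φ hφ h μ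
  exact (hmin (show ν' ∈ M from ⟨a0, Set.mem_iInter.2 fun k => (a1 k).trans (hμ k)⟩)).trans a2

end Abstract

section Entropy

variable {n : Type*} [Fintype n] [DecidableEq n]

lemma spectral' {A : Matrix n n ℂ} (hA : A.IsHermitian) :
    A = (hA.eigenvectorUnitary : Matrix n n ℂ) * diagonal (fun i => (hA.eigenvalues i : ℂ)) *
      (hA.eigenvectorUnitary : Matrix n n ℂ)ᴴ := by
  conv_lhs => rw [hA.spectral_theorem, Unitary.conjStarAlgAut_apply]
  rfl

lemma vnEntropy_eq {A : Matrix n n ℂ} (hA : A.IsHermitian) :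
    vnEntropy A = (trace (cfc Real.negMulLog A)).re := by
  rw [hA.cfc_eq, IsHermitian.cfc, Unitary.conjStarAlgAut_apply, trace_mul_comm, ← mul_assoc]
  simp [vnEntropy, hA, trace]

open scoped Matrix.Norms.L2Operator in
lemma continuous_entropy {Y : Type*} [TopologicalSpace Y] (a : Y → Matrix n n ℂ)
    (ha : Continuous a) (hh : ∀ y, (a y).IsHermitian) : Continuous fun y => vnEntropy (a y) := by
  have h : Continuous fun y => cfc Real.negMulLog (a y) :=
    Continuous.cfc_of_mem_nhdsSet (s := Set.univ) Real.negMulLog Filter.univ_mem ha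
      (fun y => (hh y).isSelfAdjoint) Real.continuous_negMulLog.continuousOn
  simp only [vnEntropy_eq (hh _)]
  exact Complex.continuous_re.comp h.matrix_trace

/-- Diagonal entries in a rotated basis. -/
lemma diag_conj (X : Matrix n n ℂ) (d : n → ℝ) (j : n) :
    ((X * diagonal (fun i => (d i : ℂ)) * Xᴴ) j j) = ((∑ k, ‖X j k‖ ^ 2 * d k : ℝ) : ℂ) := by
  rw [Matrix.mul_apply]
  push_cast
  refine Finset.sum_congr rfl fun k _ => ?_
  rw [Matrix.mul_diagonal, Matrix.conjTranspose_apply, mul_right_comm, RCLike.star_def,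
    Complex.mul_conj, Complex.normSq_eq_norm_sq]
  push_cast
  rfl

lemma row_sum {X : Matrix n n ℂ} (hX : X * Xᴴ = 1) (j : n) : ∑ k, ‖X j k‖ ^ 2 = 1 := by
  have := diag_conj X (fun _ => 1) j
  simp only [Complex.ofReal_one, diagonal_one, mul_one, hX, one_apply_eq] at this
  exact_mod_cast this.symm

lemma col_sum {X : Matrix n n ℂ} (hX : Xᴴ * X = 1) (k : n) : ∑ j, ‖X j k‖ ^ 2 = 1 := by
  have := row_sum (X := Xᴴ) (by simpa using hX) k
  simpa using this

lemma peierls {A : Matrix n n ℂ} (hA : A.PosSemidef) (U : Matrix n n ℂ) (h1 : U * Uᴴ = 1)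
    (h2 : Uᴴ * U = 1) :
    vnEntropy A ≤ ∑ j, Real.negMulLog ((Uᴴ * A * U) j j).re := by
  set W := (hA.1.eigenvectorUnitary : Matrix n n ℂ) with hW
  have w1 : W * Wᴴ = 1 := Unitary.coe_mul_star_self hA.1.eigenvectorUnitary
  have w2 : Wᴴ * W = 1 := Unitary.coe_star_mul_self hA.1.eigenvectorUnitary
  set X := Uᴴ * W with hX
  have x1 : X * Xᴴ = 1 := by
    rw [hX, conjTranspose_mul, conjTranspose_conjTranspose, Matrix.mul_assoc,
      ← Matrix.mul_assoc W, w1, Matrix.one_mul, h2]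
  have x2 : Xᴴ * X = 1 := by
    rw [hX, conjTranspose_mul, conjTranspose_conjTranspose, Matrix.mul_assoc,
      ← Matrix.mul_assoc U, h1, Matrix.one_mul, w2]
  have e : Uᴴ * A * U = X * diagonal (fun i => (hA.1.eigenvalues i : ℂ)) * Xᴴ := by
    conv_lhs => rw [spectral' hA.1]
    simp only [hX, conjTranspose_mul, conjTranspose_conjTranspose, Matrix.mul_assoc, hW]
  have key : ∀ j, ∑ k, ‖X j k‖ ^ 2 * Real.negMulLog (hA.1.eigenvalues k) ≤
      Real.negMulLog ((Uᴴ * A * U) j j).re := by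
    intro j
    rw [e, diag_conj, Complex.ofReal_re]
    have := Real.concaveOn_negMulLog.le_map_sum (t := Finset.univ) (w := fun k => ‖X j k‖ ^ 2)
      (p := hA.1.eigenvalues) (fun _ _ => by positivity) (row_sum x1 j)
      (fun k _ => hA.eigenvalues_nonneg k)
    simpa using this
  calc vnEntropy A = ∑ k, Real.negMulLog (hA.1.eigenvalues k) := by simp [vnEntropy, hA.1]
    _ = ∑ k, ∑ j, ‖X j k‖ ^ 2 * Real.negMulLog (hA.1.eigenvalues k) := by
        simp [← Finset.sum_mul, col_sum x2]
    _ = ∑ j, ∑ k, ‖X j k‖ ^ 2 * Real.negMulLog (hA.1.eigenvalues k) := Finset.sum_comm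
    _ ≤ _ := Finset.sum_le_sum fun j _ => key j

lemma entropy_concave {ι : Type*} [Fintype ι] (p : ι → ℝ) (hp0 : ∀ i, 0 ≤ p i)
    (hp1 : ∑ i, p i = 1) (A : ι → Matrix n n ℂ) (hA : ∀ i, (A i).PosSemidef)
    (M : Matrix n n ℂ) (hM : M = ∑ i, (p i : ℂ) • A i) (hMh : M.IsHermitian) :
    ∑ i, p i * vnEntropy (A i) ≤ vnEntropy M := by
  set U := (hMh.eigenvectorUnitary : Matrix n n ℂ) with hU
  have w1 : U * Uᴴ = 1 := Unitary.coe_mul_star_self hMh.eigenvectorUnitary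
  have w2 : Uᴴ * U = 1 := Unitary.coe_star_mul_self hMh.eigenvectorUnitary
  have e : Uᴴ * M * U = diagonal (fun i => (hMh.eigenvalues i : ℂ)) := by
    conv_lhs => rw [spectral' hMh]
    rw [← hU]
    simp only [Matrix.mul_assoc, w2, Matrix.mul_one]
    rw [← Matrix.mul_assoc, w2, Matrix.one_mul]
  have e2 : ∀ j, hMh.eigenvalues j = ∑ i, p i * ((Uᴴ * A i * U) j j).re := by
    intro j
    have h := congrArg Complex.re (congrFun (congrFun e j) j)
    rw [diagonal_apply_eq, Complex.ofReal_re] at h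
    rw [← h, hM, Matrix.mul_sum, Matrix.sum_mul, Matrix.sum_apply, Complex.re_sum]
    refine Finset.sum_congr rfl fun i _ => ?_
    rw [Matrix.mul_smul, Matrix.smul_mul, Matrix.smul_apply, smul_eq_mul, Complex.re_ofReal_mul]
  have nn : ∀ i j, 0 ≤ ((Uᴴ * A i * U) j j).re := fun i j =>
    (Complex.nonneg_iff.1 (((hA i).conjTranspose_mul_mul_same U).diag_nonneg (i := j))).1
  calc ∑ i, p i * vnEntropy (A i)
      ≤ ∑ i, p i * ∑ j, Real.negMulLog ((Uᴴ * A i * U) j j).re :=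
        Finset.sum_le_sum fun i _ => mul_le_mul_of_nonneg_left (peierls (hA i) U w1 w2) (hp0 i)
    _ = ∑ j, ∑ i, p i * Real.negMulLog ((Uᴴ * A i * U) j j).re := by
        simp only [Finset.mul_sum]; exact Finset.sum_comm
    _ ≤ ∑ j, Real.negMulLog (hMh.eigenvalues j) := by
        refine Finset.sum_le_sum fun j _ => ?_
        rw [e2]
        have := Real.concaveOn_negMulLog.le_map_sum (t := Finset.univ) (w := p)
          (p := fun i => ((Uᴴ * A i * U) j j).re) (fun i _ => hp0 i) hp1
          (fun i _ => nn i j)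
        simpa using this
    _ = vnEntropy M := by simp [vnEntropy, hMh]

end Entropy

section Quantum

lemma ptraceE_eq_sum {dB dE : ℕ} (M : Matrix (Fin dB × Fin dE) (Fin dB × Fin dE) ℂ) :
    ptraceE M = ∑ e, M.submatrix (fun b => (b, e)) (fun b => (b, e)) := by
  ext b b'
  simp [ptraceE, Matrix.sum_apply]

lemma chanPhi_posSemidef {dA dB dE : ℕ} (V : Matrix (Fin dB × Fin dE) (Fin dA) ℂ)
    {A : Matrix (Fin dA) (Fin dA) ℂ} (hA : A.PosSemidef) : (chanPhi V A).PosSemidef := by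
  rw [chanPhi, ptraceE_eq_sum]
  exact posSemidef_sum _ fun e _ => (hA.mul_mul_conjTranspose_same V).submatrix _

lemma chanPhi_sum {dA dB dE : ℕ} (V : Matrix (Fin dB × Fin dE) (Fin dA) ℂ) {ι : Type*}
    [Fintype ι] (c : ι → ℂ) (A : ι → Matrix (Fin dA) (Fin dA) ℂ) :
    chanPhi V (∑ i, c i • A i) = ∑ i, c i • chanPhi V (A i) := by
  ext b b'
  simp only [chanPhi, ptraceE, of_apply, Matrix.mul_sum, Matrix.sum_mul, Matrix.mul_smul,
    Matrix.smul_mul, Matrix.sum_apply, Matrix.smul_apply, Finset.smul_sum]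
  exact Finset.sum_comm

lemma continuous_chanPhi {dA dB dE : ℕ} (V : Matrix (Fin dB × Fin dE) (Fin dA) ℂ) :
    Continuous (chanPhi V) := by
  have h : Continuous fun A : Matrix (Fin dA) (Fin dA) ℂ => V * A * Vᴴ :=
    (continuous_const.matrix_mul continuous_id).matrix_mul continuous_const
  refine continuous_matrix fun b b' => ?_
  simp only [chanPhi, ptraceE, of_apply]
  exact continuous_finsetSum _ fun e _ => h.matrix_elem _ _

lemma state_entry_bound {n : ℕ} {A : Matrix (Fin n) (Fin n) ℂ} (hA : A ∈ stateSet n) (i j : Fin n) :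
    ‖A i j‖ ≤ 1 := by
  obtain ⟨hp, ht⟩ := hA
  have hs : ∑ k, hp.1.eigenvalues k = 1 := by
    have := hp.1.trace_eq_sum_eigenvalues
    rw [ht] at this
    have h2 := congrArg Complex.re this
    simpa using h2.symm
  have e := congrFun (congrFun (spectral' hp.1) i) j
  rw [e, Matrix.mul_apply, ← hs]
  refine (norm_sum_le _ _).trans (Finset.sum_le_sum fun k _ => ?_)
  rw [Matrix.mul_diagonal, conjTranspose_apply, norm_mul, norm_mul, norm_star, Complex.norm_real,
    Real.norm_of_nonneg (hp.eigenvalues_nonneg k)]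
  have h1 := entry_norm_bound_of_unitary hp.1.eigenvectorUnitary.2 i k
  have h2 := entry_norm_bound_of_unitary hp.1.eigenvectorUnitary.2 j k
  have h0 := hp.eigenvalues_nonneg k
  calc _ ≤ 1 * hp.1.eigenvalues k * 1 := by gcongr
    _ = _ := by ring

lemma isClosed_stateSet (n : ℕ) : IsClosed (stateSet n) := by
  have : stateSet n = ({A | Aᴴ = A} ∩ ⋂ x : Fin n → ℂ, {A | 0 ≤ star x ⬝ᵥ (A *ᵥ x)}) ∩
      {A | A.trace = 1} := by
    ext A
    simp only [stateSet, posSemidef_iff_dotProduct_mulVec, IsHermitian, Set.mem_inter_iff,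
      Set.mem_iInter, Set.mem_ofPred_eq]
  rw [this]
  refine ((isClosed_eq (by fun_prop) (by fun_prop)).inter (isClosed_iInter fun x => ?_)).inter
    (isClosed_eq (by fun_prop) (by fun_prop))
  exact isClosed_le continuous_const
    (continuous_const.dotProduct (continuous_id.matrix_mulVec continuous_const))

instance compactSpace_stateSet (n : ℕ) : CompactSpace (stateSet n) := by
  rw [← isCompact_iff_compactSpace]
  refine ((isCompact_closedBall (0 : ℂ) 1).matrix (m := Fin n) (n := Fin n)).of_isClosed_subset
    (isClosed_stateSet n) fun A hA => ?_
  intro i j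
  simpa using state_entry_bound hA i j

/-- Coordinates of a state. -/
def coord {n : ℕ} : (Fin n × Fin n) ⊕ (Fin n × Fin n) → stateSet n → ℝ
  | Sum.inl p, σ => (σ.1 p.1 p.2).re
  | Sum.inr p, σ => (σ.1 p.1 p.2).im

lemma continuous_coord {n : ℕ} (k : (Fin n × Fin n) ⊕ (Fin n × Fin n)) :
    Continuous (coord k) := by
  rcases k with p | p
  · exact Complex.continuous_re.comp (continuous_subtype_val.matrix_elem _ _)
  · exact Complex.continuous_im.comp (continuous_subtype_val.matrix_elem _ _)

lemma barycenter_iff {n : ℕ} (μ : ProbabilityMeasure (stateSet n)) (σ : stateSet n) :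
    barycenter μ = σ.1 ↔ ∀ k, ∫ y, coord k y ∂(μ : Measure (stateSet n)) = coord k σ := by
  have hint : ∀ i j, Integrable (fun y : stateSet n => y.1 i j) (μ : Measure (stateSet n)) := by
    intro i j
    have hc : Continuous (fun y : stateSet n => y.1 i j) := continuous_subtype_val.matrix_elem _ _
    exact (BoundedContinuousFunction.mkOfCompact ⟨_, hc⟩).integrable (μ : Measure (stateSet n))
  have hre : ∀ i j, ∫ y : stateSet n, (y.1 i j).re ∂(μ : Measure (stateSet n)) =
      (barycenter μ i j).re := fun i j => Complex.reCLM.integral_comp_comm (hint i j)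
  have him : ∀ i j, ∫ y : stateSet n, (y.1 i j).im ∂(μ : Measure (stateSet n)) =
      (barycenter μ i j).im := fun i j => Complex.imCLM.integral_comp_comm (hint i j)
  constructor
  · rintro h (⟨i, j⟩ | ⟨i, j⟩)
    · simp only [coord, hre, h]
    · simp only [coord, him, h]
  · intro h
    ext i j
    apply Complex.ext
    · rw [← hre]; exact h (Sum.inl (i, j))
    · rw [← him]; exact h (Sum.inr (i, j))

/-- Deviation from purity. -/
noncomputable def impurity {n : ℕ} (σ : stateSet n) : ℝ := ∑ i, ∑ j, ‖(σ.1 * σ.1 - σ.1 : Matrix (Fin n) (Fin n) ℂ) i j‖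

lemma continuous_impurity {n : ℕ} : Continuous (impurity (n := n)) := by
  have h : Continuous fun σ : stateSet n => σ.1 * σ.1 - σ.1 :=
    (continuous_subtype_val.matrix_mul continuous_subtype_val).sub continuous_subtype_val
  exact continuous_finsetSum _ fun i _ => continuous_finsetSum _ fun j _ =>
    (h.matrix_elem i j).norm

lemma impurity_nonneg {n : ℕ} (σ : stateSet n) : 0 ≤ impurity σ :=
  Finset.sum_nonneg fun _ _ => Finset.sum_nonneg fun _ _ => norm_nonneg _

lemma impurity_eq_zero {n : ℕ} (σ : stateSet n) : impurity σ = 0 ↔ σ ∈ pureStates n := by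
  rw [impurity, Finset.sum_eq_zero_iff_of_nonneg
    (s := Finset.univ) (f := fun i => ∑ j, ‖(σ.1 * σ.1 - σ.1 : Matrix (Fin n) (Fin n) ℂ) i j‖)
    (fun _ _ => Finset.sum_nonneg fun _ _ => norm_nonneg _)]
  simp only [Finset.mem_univ, true_imp_iff]
  have : ∀ i, (∑ j, ‖(σ.1 * σ.1 - σ.1 : Matrix (Fin n) (Fin n) ℂ) i j‖ = 0 ↔ ∀ j, (σ.1 * σ.1 - σ.1 : Matrix (Fin n) (Fin n) ℂ) i j = 0) := by
    intro i
    rw [Finset.sum_eq_zero_iff_of_nonneg (fun _ _ => norm_nonneg _)]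
    simp
  simp only [this]
  change _ ↔ σ.1 * σ.1 = σ.1
  rw [← sub_eq_zero (a := σ.1 * σ.1), ← Matrix.ext_iff]
  rfl

lemma pure_of_impurity {n : ℕ} (ν : ProbabilityMeasure (stateSet n))
    (h : ∫ y, impurity y ∂(ν : Measure (stateSet n)) = 0) :
    (ν : Measure (stateSet n)) (pureStates n) = 1 := by
  rw [integral_eq_zero_iff_of_nonneg impurity_nonneg
    (integrable_cont ν continuous_impurity)] at h
  rw [← measure_univ (μ := (ν : Measure (stateSet n)))]
  refine measure_congr ?_
  filter_upwards [h] with σ hσ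
  have : σ ∈ pureStates n := (impurity_eq_zero σ).1 hσ
  exact eq_true this

lemma exists_decomp {n : ℕ} (σ : stateSet n) : ∃ (p : Fin n → ℝ) (P : Fin n → stateSet n),
    (∀ i, 0 ≤ p i) ∧ ∑ i, p i = 1 ∧ (∀ i, P i ∈ pureStates n) ∧
    σ.1 = ∑ i, (p i : ℂ) • (P i).1 := by
  obtain ⟨A, hp, ht⟩ := σ
  set W := (hp.1.eigenvectorUnitary : Matrix (Fin n) (Fin n) ℂ) with hW
  have w2 : Wᴴ * W = 1 := Unitary.coe_star_mul_self hp.1.eigenvectorUnitary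
  let D : Fin n → Matrix (Fin n) (Fin n) ℂ := fun i => diagonal (Pi.single i 1)
  have hD : ∀ i, (D i).PosSemidef := fun i => PosSemidef.diagonal (Pi.single_nonneg.2 zero_le_one)
  have hDD : ∀ i, D i * D i = D i := by
    intro i
    simp only [D, diagonal_mul_diagonal]
    congr 1
    funext k
    by_cases h : k = i
    · subst h; simp
    · simp [h]
  refine ⟨hp.1.eigenvalues, fun i => ⟨W * D i * Wᴴ, (hD i).mul_mul_conjTranspose_same W, ?_⟩,
    hp.eigenvalues_nonneg, ?_, ?_, ?_⟩
  · rw [trace_mul_comm, ← Matrix.mul_assoc, w2, Matrix.one_mul]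
    simp [D, trace_diagonal]
  · have := hp.1.trace_eq_sum_eigenvalues
    rw [ht] at this
    have h2 := congrArg Complex.re this
    simpa using h2.symm
  · intro i
    change W * D i * Wᴴ * (W * D i * Wᴴ) = W * D i * Wᴴ
    calc W * D i * Wᴴ * (W * D i * Wᴴ) = W * (D i * (Wᴴ * W) * D i) * Wᴴ := by
          simp only [Matrix.mul_assoc]
      _ = _ := by rw [w2, Matrix.mul_one, hDD]
  · have : diagonal (fun i => (hp.1.eigenvalues i : ℂ)) =
        ∑ i, (hp.1.eigenvalues i : ℂ) • D i := by
      ext a b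
      by_cases h : a = b
      · subst h; simp [D, Matrix.sum_apply, Pi.single_apply]
      · simp [D, Matrix.sum_apply, h]
    change A = _
    conv_lhs => rw [spectral' hp.1, this]
    simp only [Matrix.mul_sum, Matrix.sum_mul, Matrix.mul_smul, Matrix.smul_mul, hW]

end Quantum

end ChiAux

/-- For every state `ρ`, the supremum defining the χ-function `C̄(Φ, ρ)` is attained at an
ensemble supported by pure states. -/
theorem exists_pure_ensemble_attaining_chi_function
    (dA dB dE : ℕ) (hdA : 0 < dA) (hdB : 0 < dB) (hdE : 0 < dE)
    (V : Matrix (Fin dB × Fin dE) (Fin dA) ℂ) (hV : Vᴴ * V = 1)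
    (ρ : stateSet dA) :
    ∃ μs : ProbabilityMeasure (stateSet dA),
      (μs : Measure (stateSet dA)) (pureStates dA) = 1 ∧
      barycenter μs = ρ.1 ∧
      gChiOut (chanPhi V) μs
        = sSup {x : ℝ | ∃ μ : ProbabilityMeasure (stateSet dA),
            barycenter μ = ρ.1 ∧ gChiOut (chanPhi V) μ = x} := by
  classical
  let f : stateSet dA → ℝ := fun σ => vnEntropy (chanPhi V σ.1)
  have hf : Continuous f := ChiAux.continuous_entropy _
    ((ChiAux.continuous_chanPhi V).comp continuous_subtype_val)
    fun σ => (ChiAux.chanPhi_posSemidef V σ.2.1).1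
  obtain ⟨ν, h0, h1, h2⟩ := ChiAux.exists_min ChiAux.coord ChiAux.continuous_coord f hf
    ChiAux.impurity ChiAux.continuous_impurity (by
      intro σ
      obtain ⟨p, P, hp0, hp1, hP, hσ⟩ := ChiAux.exists_decomp σ
      obtain ⟨ν, hν⟩ := ChiAux.exists_mix p hp0 hp1
        (fun i => (⟨Measure.dirac (P i), inferInstance⟩ : ProbabilityMeasure (stateSet dA)))
      have hν' : ∀ g : stateSet dA → ℝ, Continuous g →
          ∫ x, g x ∂(ν : Measure (stateSet dA)) = ∑ i, p i * g (P i) := by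
        intro g hg
        rw [hν g hg]
        refine Finset.sum_congr rfl fun i _ => ?_
        rw [ProbabilityMeasure.coe_mk, integral_dirac' _ _ hg.stronglyMeasurable]
      refine ⟨ν, ?_, ?_, ?_⟩
      · rw [hν' _ ChiAux.continuous_impurity]
        exact Finset.sum_eq_zero fun i _ => by rw [(ChiAux.impurity_eq_zero _).2 (hP i), mul_zero]
      · intro k
        rw [hν' _ (ChiAux.continuous_coord k)]
        rcases k with k | k
        · simp only [ChiAux.coord]
          rw [hσ, Matrix.sum_apply, Complex.re_sum]
          simp [Matrix.smul_apply]
        · simp only [ChiAux.coord]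
          rw [hσ, Matrix.sum_apply, Complex.im_sum]
          simp [Matrix.smul_apply]
      · rw [hν' f hf]
        refine ChiAux.entropy_concave p hp0 hp1 (fun i => chanPhi V (P i).1)
          (fun i => ChiAux.chanPhi_posSemidef V (P i).2.1) _ ?_
          (ChiAux.chanPhi_posSemidef V σ.2.1).1
        rw [hσ, ChiAux.chanPhi_sum]) ρ
  have hb := (ChiAux.barycenter_iff ν ρ).2 h1
  refine ⟨ν, ChiAux.pure_of_impurity ν h0, hb, ?_⟩
  symm
  apply IsGreatest.csSup_eq
  refine ⟨⟨ν, hb, rfl⟩, ?_⟩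
  rintro _ ⟨μ, hμ, rfl⟩
  simp only [gChiOut, hb, hμ]
  exact sub_le_sub_left (h2 μ ((ChiAux.barycenter_iff μ ρ).1 hμ)) _
end
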